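/- Let f be a Gaussian random field on ℝ with mean function m and covariance function k such that m and k are smooth (infinitely differentiable). Then the iterated derivative random fields D^i f exist for all i ∈ ℕ (with D⁰f = f and D^{i+1}f(x) the L² limit of difference quotients of D^i f at x), and the infinite order augmented random field is Gaussian: for every finite collection of pairs (x_l, i_l) ∈ ℝ × ℕ, l = 1,…,N, and real coefficients c₁,…,c_N, the random variable ∑_l c_l · (D^{i_l} f)(x_l) has a (possibly degenerate) Gaussian distribution on ℝ. -/

import Mathlib

open MeasureTheory ProbabilityTheory Filter Topology
open scoped NNReal

/-- A real random variable has a (possibly degenerate) Gaussian distribution. -/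
def IsGaussianRV {Ω : Type*} [MeasurableSpace Ω] (P : Measure Ω) (ξ : Ω → ℝ) : Prop :=
  Measurable ξ ∧ ∃ (μ : ℝ) (v : ℝ≥0), Measure.map ξ P = gaussianReal μ v

/-- A Gaussian random field on a set `X`: every finite linear combination of its
values is a (possibly degenerate) Gaussian random variable. -/
def IsGaussianRF {Ω : Type*} [MeasurableSpace Ω] (P : Measure Ω) {X : Type*}
    (f : X → Ω → ℝ) : Prop :=
  (∀ x, Measurable (f x)) ∧
  ∀ (p : ℕ) (x : Fin p → X) (c : Fin p → ℝ),
    IsGaussianRV P (fun ω => ∑ i, c i * f (x i) ω)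

/-- `Df` is the derivative random field of `f`: at every point, the difference
quotients of `f` converge to `Df` in mean square. -/
def IsDerivField {Ω : Type*} [MeasurableSpace Ω] (P : Measure Ω)
    (f Df : ℝ → Ω → ℝ) : Prop :=
  (∀ x, Measurable (Df x)) ∧
  ∀ x : ℝ, Tendsto (fun δ : ℝ => ∫ ω, ((f (x + δ) ω - f x ω) / δ - Df x ω) ^ 2 ∂P)
    (𝓝[≠] 0) (𝓝 0)

/-- The mixed second difference of `K` at the diagonal point `(x, x)` is approximated by the mixed
partial derivative. -/
lemma exists_abs_mixed_difference_sub_le {K K₁ K₂ : ℝ × ℝ → ℝ} {x : ℝ}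
    (h₁ : ∀ s t, HasDerivAt (fun u => K (u, t)) (K₁ (s, t)) s)
    (h₂ : ∀ s t, HasDerivAt (fun u => K₁ (s, u)) (K₂ (s, t)) t)
    (hc : ContinuousAt K₂ (x, x)) {ε : ℝ} (hε : 0 < ε) :
    ∃ r > 0, ∀ a b : ℝ, |a| < r → |b| < r →
      |K (x + a, x + b) - K (x + a, x) - K (x, x + b) + K (x, x) - K₂ (x, x) * a * b|
        ≤ ε * |b| * |a| := by
  obtain ⟨r, hr, hK⟩ := Metric.continuousAt_iff.1 hc ε hε
  refine ⟨r, hr, fun a b ha hb => ?_⟩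
  have hx : x ∈ Metric.ball x r := Metric.mem_ball_self hr
  have hmem : ∀ c : ℝ, |c| < r → x + c ∈ Metric.ball x r := fun c h => by
    simpa [Real.dist_eq] using h
  have inner_bound : ∀ s ∈ Metric.ball x r,
      ‖K₁ (s, x + b) - K₁ (s, x) - K₂ (x, x) * b‖ ≤ ε * |b| := by
    intro s hs
    have := Convex.norm_image_sub_le_of_norm_hasDerivWithin_le (C := ε)
      (f := fun u => K₁ (s, u) - K₂ (x, x) * u) (f' := fun u => K₂ (s, u) - K₂ (x, x))
      (s := Metric.ball x r) (x := x) (y := x + b)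
      (fun u _ => ((h₂ s u).fun_sub
        (by simpa using (hasDerivAt_id u).const_mul (K₂ (x, x)))).hasDerivWithinAt)
      (fun u hu => by
        rw [← dist_eq_norm]
        exact (hK (by rw [Prod.dist_eq]; exact max_lt hs hu)).le)
      (convex_ball x r) hx (hmem b hb)
    rw [add_sub_cancel_left, Real.norm_eq_abs b] at this
    convert this using 1
    congr 1
    ring
  have := Convex.norm_image_sub_le_of_norm_hasDerivWithin_le (C := ε * |b|)
    (f := fun u => K (u, x + b) - K (u, x) - K₂ (x, x) * b * u)
    (f' := fun u => K₁ (u, x + b) - K₁ (u, x) - K₂ (x, x) * b)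
    (s := Metric.ball x r) (x := x) (y := x + a)
    (fun u _ => (((h₁ u (x + b)).fun_sub (h₁ u x)).fun_sub
      (by simpa using (hasDerivAt_id u).const_mul (K₂ (x, x) * b))).hasDerivWithinAt)
    inner_bound (convex_ball x r) hx (hmem a ha)
  rw [add_sub_cancel_left, Real.norm_eq_abs a, Real.norm_eq_abs] at this
  convert this using 2
  ring

section HilbertCurve

variable {H : Type*} [NormedAddCommGroup H] [InnerProductSpace ℝ H]

/-- A curve in a Hilbert space is differentiable wherever its reproducing kernel has a continuous
mixed second partial derivative. -/
lemma differentiableAt_of_inner_eq [CompleteSpace H] {F : ℝ → H} {K K₁ K₂ : ℝ × ℝ → ℝ}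
    (hF : ∀ s t, inner ℝ (F s) (F t) = K (s, t))
    (h₁ : ∀ s t, HasDerivAt (fun u => K (u, t)) (K₁ (s, t)) s)
    (h₂ : ∀ s t, HasDerivAt (fun u => K₁ (s, u)) (K₂ (s, t)) t)
    {x : ℝ} (hc : ContinuousAt K₂ (x, x)) : DifferentiableAt ℝ F x := by
  set D : ℝ → H := fun a => a⁻¹ • (F (x + a) - F x) with hD
  have hcauchy : Cauchy (map D (𝓝[≠] 0)) := by
    refine Metric.cauchy_iff.2 ⟨inferInstance, fun η hη => ?_⟩
    obtain ⟨r, hr, hK⟩ := exists_abs_mixed_difference_sub_le h₁ h₂ hc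
      (show (0 : ℝ) < η ^ 2 / 8 by positivity)
    have hinner : ∀ a b : ℝ, a ≠ 0 → b ≠ 0 → |a| < r → |b| < r →
        |inner ℝ (D a) (D b) - K₂ (x, x)| ≤ η ^ 2 / 8 := by
      intro a b ha hb har hbr
      have hpos : 0 < |b| * |a| := by positivity
      refine le_of_mul_le_mul_right ?_ hpos
      rw [← abs_mul, ← abs_mul, abs_mul b a,
        ← mul_assoc (η ^ 2 / 8)]
      convert hK a b har hbr using 1
      congr 1
      simp only [hD, real_inner_smul_left, real_inner_smul_right, inner_sub_left,
        inner_sub_right, hF]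
      field_simp
      ring_nf
    refine ⟨D '' {a | a ≠ 0 ∧ |a| < r}, image_mem_map ?_, ?_⟩
    · refine inter_mem self_mem_nhdsWithin (mem_nhdsWithin_of_mem_nhds ?_)
      filter_upwards [Metric.ball_mem_nhds (0 : ℝ) hr] with a ha
      change |a| < r
      simpa [Real.dist_eq] using ha
    · rintro _ ⟨a, ⟨ha, har⟩, rfl⟩ _ ⟨b, ⟨hb, hbr⟩, rfl⟩
      rw [dist_eq_norm]
      refine lt_of_pow_lt_pow_left₀ 2 hη.le ?_
      have haa := abs_le.1 (hinner a a ha ha har har)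
      have hab := abs_le.1 (hinner a b ha hb har hbr)
      have hbb := abs_le.1 (hinner b b hb hb hbr hbr)
      rw [norm_sub_sq_real, ← real_inner_self_eq_norm_sq, ← real_inner_self_eq_norm_sq]
      nlinarith [sq_pos_of_pos hη]
  obtain ⟨F', hF'⟩ := CompleteSpace.complete hcauchy
  exact (hasDerivAt_iff_tendsto_slope_zero.2 hF').differentiableAt

/-- A curve in a Hilbert space with smooth reproducing kernel is differentiable, and the kernel of
its derivative is again smooth. -/
lemma differentiable_and_contDiff_inner_deriv [CompleteSpace H] {F : ℝ → H}
    (hF : ContDiff ℝ (⊤ : ℕ∞) (fun p : ℝ × ℝ => (inner ℝ (F p.1) (F p.2) : ℝ))) :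
    Differentiable ℝ F ∧
      ContDiff ℝ (⊤ : ℕ∞) (fun p : ℝ × ℝ => (inner ℝ (deriv F p.1) (deriv F p.2) : ℝ)) := by
  set K : ℝ × ℝ → ℝ := fun p => inner ℝ (F p.1) (F p.2) with hK
  set K₁ : ℝ × ℝ → ℝ := fun p => fderiv ℝ K p (1, 0) with hK₁
  set K₂ : ℝ × ℝ → ℝ := fun p => fderiv ℝ K₁ p (0, 1) with hK₂
  have hc₁ : ContDiff ℝ (⊤ : ℕ∞) K₁ :=
    (hF.fderiv_right (m := (⊤ : ℕ∞)) (by simp)).clm_apply contDiff_const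
  have hc₂ : ContDiff ℝ (⊤ : ℕ∞) K₂ :=
    (hc₁.fderiv_right (m := (⊤ : ℕ∞)) (by simp)).clm_apply contDiff_const
  have h₁ : ∀ s t, HasDerivAt (fun u => K (u, t)) (K₁ (s, t)) s := fun s t =>
    HasFDerivAt.comp_hasDerivAt (l := K) s ((hF.differentiable (by simp)) (s, t)).hasFDerivAt
      ((hasDerivAt_id s).prodMk (hasDerivAt_const s t))
  have h₂ : ∀ s t, HasDerivAt (fun u => K₁ (s, u)) (K₂ (s, t)) t := fun s t =>
    HasFDerivAt.comp_hasDerivAt (l := K₁) t ((hc₁.differentiable (by simp)) (s, t)).hasFDerivAt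
      ((hasDerivAt_const t s).prodMk (hasDerivAt_id t))
  have hd : Differentiable ℝ F := fun x =>
    differentiableAt_of_inner_eq (fun _ _ => rfl) h₁ h₂ hc₂.continuous.continuousAt
  have e₁ : ∀ s t, inner ℝ (deriv F s) (F t) = K₁ (s, t) := fun s t => by
    simpa using ((hd s).hasDerivAt.inner ℝ (hasDerivAt_const s (F t))).unique (h₁ s t)
  have e₂ : ∀ s t, inner ℝ (deriv F s) (deriv F t) = K₂ (s, t) := fun s t => by
    have h := (hasDerivAt_const t (deriv F s)).inner ℝ (hd t).hasDerivAt
    simp only [e₁] at h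
    simpa using h.unique (h₂ s t)
  refine ⟨hd, ?_⟩
  convert hc₂ using 1
  exact funext fun p => e₂ p.1 p.2

lemma differentiable_iterate_deriv [CompleteSpace H] {F : ℝ → H}
    (hF : ContDiff ℝ (⊤ : ℕ∞) (fun p : ℝ × ℝ => (inner ℝ (F p.1) (F p.2) : ℝ))) (n : ℕ) :
    Differentiable ℝ (deriv^[n] F) := by
  induction n generalizing F with
  | zero => exact (differentiable_and_contDiff_inner_deriv hF).1
  | succ n ih => exact ih (differentiable_and_contDiff_inner_deriv hF).2

end HilbertCurve

lemma iterate_deriv_mem_topologicalClosure_span {E : Type*} [NormedAddCommGroup E]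
    [NormedSpace ℝ E] (F : ℝ → E) (n : ℕ) (x : ℝ) :
    deriv^[n] F x ∈ (Submodule.span ℝ (Set.range F)).topologicalClosure := by
  induction n generalizing x with
  | zero => exact Submodule.le_topologicalClosure _ (Submodule.subset_span ⟨x, rfl⟩)
  | succ n ih =>
    rw [Function.iterate_succ_apply']
    have h := range_deriv_subset_closure_span_image (deriv^[n] F) dense_univ ⟨x, rfl⟩
    refine closure_minimal (Submodule.span_le.2 ?_)
      (Submodule.isClosed_topologicalClosure _) h
    rintro _ ⟨y, -, rfl⟩
    exact ih y

section GaussianLp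

variable {Ω : Type*} [MeasurableSpace Ω] {P : Measure Ω}

lemma integral_norm_le_norm_Lp_two [IsProbabilityMeasure P] (u : Lp ℝ 2 P) :
    ∫ ω, ‖u ω‖ ∂P ≤ ‖u‖ := by
  rw [integral_norm_eq_lintegral_enorm (Lp.aestronglyMeasurable u),
    ← eLpNorm_one_eq_lintegral_enorm, Lp.norm_def]
  exact ENNReal.toReal_mono (Lp.eLpNorm_ne_top u)
    (eLpNorm_le_eLpNorm_of_exponent_le (by norm_num) (Lp.aestronglyMeasurable u))

lemma norm_sq_Lp_two (u : Lp ℝ 2 P) : ‖u‖ ^ 2 = ∫ ω, u ω ^ 2 ∂P := by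
  rw [← real_inner_self_eq_norm_sq, L2.inner_def]
  simp [pow_two]

lemma integrable_Lp_two [IsFiniteMeasure P] (u : Lp ℝ 2 P) : Integrable u P :=
  (Lp.memLp u).integrable (by norm_num)

lemma norm_cexp_mul_I_sub_cexp_mul_I_le (a b : ℝ) :
    ‖Complex.exp (a * Complex.I) - Complex.exp (b * Complex.I)‖ ≤ |a - b| := by
  have h : Complex.exp (a * Complex.I) - Complex.exp (b * Complex.I) =
      Complex.exp (b * Complex.I) * (Complex.exp (Complex.I * (a - b : ℝ)) - 1) := by
    rw [mul_sub, ← Complex.exp_add, mul_one]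
    congr 2
    push_cast
    ring
  rw [h, norm_mul, Complex.norm_exp_ofReal_mul_I, one_mul]
  exact Real.norm_exp_I_mul_ofReal_sub_one_le

/-- A function of `u ∈ L²` of the form `∫ φ (u ω)` with `φ` Lipschitz is continuous. -/
lemma continuous_integral_comp_Lp_two [IsProbabilityMeasure P] {E : Type*} [NormedAddCommGroup E]
    [NormedSpace ℝ E] {φ : ℝ → E} {C : ℝ≥0} (hφ : LipschitzWith C φ) :
    Continuous fun u : Lp ℝ 2 P => ∫ ω, φ (u ω) ∂P := by
  have hint : ∀ u : Lp ℝ 2 P, Integrable (fun ω => φ (u ω)) P := fun u => by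
    have h : Integrable (fun ω => C * ‖u ω‖ + ‖φ 0‖) P :=
      ((integrable_Lp_two u).norm.const_mul _).add (integrable_const _)
    refine h.mono' (hφ.continuous.comp_aestronglyMeasurable (Lp.aestronglyMeasurable u))
      (Eventually.of_forall fun ω => ?_)
    have h₁ := hφ.norm_sub_le (u ω) 0
    have h₂ := norm_sub_norm_le (φ (u ω)) (φ 0)
    rw [sub_zero] at h₁
    linarith
  refine (LipschitzWith.of_dist_le_mul (K := C) fun u v => ?_).continuous
  rw [dist_eq_norm, dist_eq_norm, ← integral_sub (hint u) (hint v)]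
  calc ‖∫ ω, (φ (u ω) - φ (v ω)) ∂P‖
      ≤ ∫ ω, C * ‖(u - v) ω‖ ∂P := by
        refine norm_integral_le_of_norm_le ((integrable_Lp_two (u - v)).norm.const_mul _) ?_
        filter_upwards [Lp.coeFn_sub u v] with ω h
        rw [h, Pi.sub_apply]
        exact hφ.norm_sub_le _ _
    _ ≤ C * ‖u - v‖ := by
        rw [integral_const_mul]
        exact mul_le_mul_of_nonneg_left (integral_norm_le_norm_Lp_two _) C.coe_nonneg

lemma isGaussianRV_congr {ξ ζ : Ω → ℝ} (hξ : IsGaussianRV P ξ) (hζ : Measurable ζ)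
    (h : ζ =ᵐ[P] ξ) : IsGaussianRV P ζ := by
  obtain ⟨_, μ, v, hμ⟩ := hξ
  exact ⟨hζ, μ, v, (Measure.map_congr h).trans hμ⟩

lemma IsGaussianRV.memLp_two {ξ : Ω → ℝ} (hξ : IsGaussianRV P ξ) : MemLp ξ 2 P := by
  obtain ⟨hm, μ, v, hμ⟩ := hξ
  have h : MemLp id 2 (P.map ξ) := by
    rw [hμ]
    exact memLp_id_gaussianReal 2
  exact h.comp_of_map hm.aemeasurable

/-- An element of `L²` is Gaussian iff its characteristic function is the Gaussian one with the
same first two moments. -/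
lemma isGaussianRV_Lp_two_iff [IsProbabilityMeasure P] (u : Lp ℝ 2 P) :
    IsGaussianRV P u ↔ ∀ t : ℝ, ∫ ω, Complex.exp (((t * u ω : ℝ) : ℂ) * Complex.I) ∂P =
      Complex.exp (t * (∫ ω, u ω ∂P : ℝ) * Complex.I -
        ((‖u‖ ^ 2 - (∫ ω, u ω ∂P) ^ 2 : ℝ) : ℂ) * t ^ 2 / 2) := by
  have hmeas : Measurable u := (Lp.stronglyMeasurable u).measurable
  have hchar : ∀ t : ℝ, charFun (P.map u) t =
      ∫ ω, Complex.exp (((t * u ω : ℝ) : ℂ) * Complex.I) ∂P := fun t => by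
    rw [charFun_apply_real, integral_map hmeas.aemeasurable (by fun_prop)]
    simp
  have hprob : IsProbabilityMeasure (P.map u) :=
    Measure.isProbabilityMeasure_map hmeas.aemeasurable
  constructor
  · rintro ⟨-, μ, v, hμ⟩ t
    have hmean : ∫ ω, u ω ∂P = μ := by
      have h := integral_map (μ := P) hmeas.aemeasurable (f := fun x : ℝ => x) (by fun_prop)
      rw [← h, hμ, integral_id_gaussianReal]
    have hvar : ‖u‖ ^ 2 - (∫ ω, u ω ∂P) ^ 2 = v := by
      rw [norm_sq_Lp_two]
      have h := variance_eq_sub (Lp.memLp u)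
      have h' : Var[u; P] = v := by
        rw [← variance_id_map hmeas.aemeasurable, hμ, variance_id_gaussianReal]
      rw [← h', h]
      rfl
    rw [← hchar, hvar, hmean, hμ, charFun_gaussianReal]
  · intro h
    have hnonneg : 0 ≤ ‖u‖ ^ 2 - (∫ ω, u ω ∂P) ^ 2 :=
      sub_nonneg.2 (sq_le_sq' (neg_le_of_abs_le
        ((norm_integral_le_integral_norm _).trans (integral_norm_le_norm_Lp_two u)))
        (le_of_abs_le ((norm_integral_le_integral_norm _).trans
          (integral_norm_le_norm_Lp_two u))))
    obtain ⟨v, hv⟩ : ∃ v : ℝ≥0, (v : ℝ) = ‖u‖ ^ 2 - (∫ ω, u ω ∂P) ^ 2 := ⟨⟨_, hnonneg⟩, rfl⟩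
    refine ⟨hmeas, ∫ ω, u ω ∂P, v, Measure.ext_of_charFun (funext fun t => ?_)⟩
    rw [hchar, h, charFun_gaussianReal, hv]

/-- Gaussian random variables form a closed subset of `L²`. -/
lemma isClosed_setOf_isGaussianRV [IsProbabilityMeasure P] :
    IsClosed {u : Lp ℝ 2 P | IsGaussianRV P u} := by
  simp only [isGaussianRV_Lp_two_iff, Set.ofPred_forall]
  refine isClosed_iInter fun t => isClosed_eq ?_ ?_
  · refine continuous_integral_comp_Lp_two (C := ‖t‖₊)
      (φ := fun x => Complex.exp (((t * x : ℝ) : ℂ) * Complex.I))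
      (LipschitzWith.of_dist_le_mul fun a b => ?_)
    rw [dist_eq_norm, dist_eq_norm, coe_nnnorm, ← norm_mul, mul_sub]
    exact norm_cexp_mul_I_sub_cexp_mul_I_le _ _
  · have h : Continuous fun u : Lp ℝ 2 P => ∫ ω, u ω ∂P :=
      continuous_integral_comp_Lp_two (φ := id) LipschitzWith.id
    fun_prop

lemma coeFn_sum_smul {ι : Type*} [Fintype ι] (c : ι → ℝ) (u : ι → Lp ℝ 2 P) (ζ : ι → Ω → ℝ)
    (h : ∀ i, u i =ᵐ[P] ζ i) :
    ((∑ i, c i • u i : Lp ℝ 2 P) : Ω → ℝ) =ᵐ[P] fun ω => ∑ i, c i * ζ i ω := by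
  filter_upwards [Lp.coeFn_finsetSum Finset.univ (fun i => c i • u i), ae_all_iff.2 h,
    ae_all_iff.2 fun i => Lp.coeFn_smul (c i) (u i)] with ω h₁ h₂ h₃
  rw [h₁, Finset.sum_apply]
  simp only [h₂, h₃, Pi.smul_apply, smul_eq_mul]

/-- The closed linear span of a Gaussian random field consists of Gaussian random variables. -/
lemma isGaussianRV_of_mem_topologicalClosure_span [IsProbabilityMeasure P] {X : Type*}
    {f : X → Ω → ℝ} (hf : IsGaussianRF P f) {F : X → Lp ℝ 2 P} (hF : ∀ x, F x =ᵐ[P] f x)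
    {u : Lp ℝ 2 P} (hu : u ∈ (Submodule.span ℝ (Set.range F)).topologicalClosure) :
    IsGaussianRV P u := by
  refine closure_minimal (fun w hw => ?_) isClosed_setOf_isGaussianRV hu
  obtain ⟨n, c, y, rfl⟩ := Submodule.mem_span_set'.1 hw
  choose x hx using fun i => (y i).2
  exact isGaussianRV_congr (hf.2 n x c) (Lp.stronglyMeasurable _).measurable
    (coeFn_sum_smul c _ _ fun i => hx i ▸ hF (x i))

/-- A differentiable curve in `L²` yields a mean square derivative of the random field. -/
lemma isDerivField_of_differentiable {f Df : ℝ → Ω → ℝ} {F : ℝ → Lp ℝ 2 P}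
    (hd : Differentiable ℝ F) (hf : ∀ x, F x =ᵐ[P] f x)
    (hDf : ∀ x, (deriv F x : Lp ℝ 2 P) =ᵐ[P] Df x) (hm : ∀ x, Measurable (Df x)) :
    IsDerivField P f Df := by
  refine ⟨hm, fun x => ?_⟩
  have h := hasDerivAt_iff_tendsto_slope_zero.1 (hd x).hasDerivAt
  have h' := (tendsto_iff_norm_sub_tendsto_zero.1 h).pow 2
  rw [zero_pow two_ne_zero] at h'
  refine h'.congr fun δ => ?_
  rw [norm_sq_Lp_two]
  refine integral_congr_ae ?_
  filter_upwards [hf x, hf (x + δ), hDf x, Lp.coeFn_sub (F (x + δ)) (F x),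
    Lp.coeFn_smul δ⁻¹ (F (x + δ) - F x),
    Lp.coeFn_sub (δ⁻¹ • (F (x + δ) - F x)) (deriv F x)] with ω h₁ h₂ h₃ h₄ h₅ h₆
  simp only [h₆, h₅, h₄, h₁, h₂, h₃, Pi.sub_apply, Pi.smul_apply, smul_eq_mul]
  rw [div_eq_inv_mul]

end GaussianLp

/-- For smooth mean and covariance functions, the iterated derivative random fields of all
orders exist and the infinite order augmented random field is Gaussian. -/
theorem statement14 {Ω : Type*} [MeasurableSpace Ω] (P : Measure Ω) [IsProbabilityMeasure P]
    (f : ℝ → Ω → ℝ) (m : ℝ → ℝ) (k : ℝ → ℝ → ℝ)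
    (hf : IsGaussianRF P f)
    (hm : ∀ x, m x = ∫ ω, f x ω ∂P)
    (hk : ∀ x x', k x x' = ∫ ω, (f x ω - m x) * (f x' ω - m x') ∂P)
    (hmd : ContDiff ℝ (⊤ : ℕ∞) m)
    (hkd : ContDiff ℝ (⊤ : ℕ∞) (fun p : ℝ × ℝ => k p.1 p.2)) :
    ∃ g : ℕ → ℝ → Ω → ℝ, g 0 = f ∧
      (∀ i : ℕ, IsDerivField P (g i) (g (i + 1))) ∧
      (∀ (N : ℕ) (x : Fin N → ℝ) (idx : Fin N → ℕ) (c : Fin N → ℝ),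
        IsGaussianRV P (fun ω => ∑ l, c l * g (idx l) (x l) ω)) := by
  have hL : ∀ x, MemLp (f x) 2 P := fun x => by
    simpa using (hf.2 1 (fun _ => x) (fun _ => 1)).memLp_two
  set F : ℝ → Lp ℝ 2 P := fun x => (hL x).toLp (f x)
  have hF : ∀ x, F x =ᵐ[P] f x := fun x => (hL x).coeFn_toLp
  have hinner : ∀ x y, (inner ℝ (F x) (F y) : ℝ) = k x y + m x * m y := fun x y => by
    have hcov := covariance_eq_sub (hL x) (hL y)
    rw [covariance, ← hm x, ← hm y, ← hk] at hcov
    rw [L2.inner_def, hcov, sub_add_cancel]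
    refine integral_congr_ae ?_
    filter_upwards [hF x, hF y] with ω h₁ h₂
    simp [h₁, h₂, mul_comm]
  have hsmooth : ContDiff ℝ (⊤ : ℕ∞) (fun p : ℝ × ℝ => (inner ℝ (F p.1) (F p.2) : ℝ)) := by
    simp only [hinner]
    exact hkd.add ((hmd.comp contDiff_fst).mul (hmd.comp contDiff_snd))
  let g : ℕ → ℝ → Ω → ℝ := fun i => Nat.casesOn i f fun j x => (deriv^[j + 1] F x : Lp ℝ 2 P)
  have hg : ∀ i x, (deriv^[i] F x : Lp ℝ 2 P) =ᵐ[P] g i x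
    | 0, x => hF x
    | _ + 1, _ => EventuallyEq.rfl
  have hgm : ∀ i x, Measurable (g i x)
    | 0, x => hf.1 x
    | _ + 1, _ => (Lp.stronglyMeasurable _).measurable
  refine ⟨g, rfl, fun i => ?_, fun N x idx c => ?_⟩
  · refine isDerivField_of_differentiable (differentiable_iterate_deriv hsmooth i) (hg i)
      (fun x => ?_) (hgm (i + 1))
    rw [← Function.iterate_succ_apply' deriv]
  · refine isGaussianRV_congr (isGaussianRV_of_mem_topologicalClosure_span hf hF
      (u := ∑ l, c l • deriv^[idx l] F (x l)) ?_)
      (Finset.measurable_fun_sum _ fun l _ => (hgm (idx l) (x l)).const_mul _)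
      (coeFn_sum_smul c _ _ fun l => hg (idx l) (x l)).symm
    exact Submodule.sum_mem _ fun l _ => Submodule.smul_mem _ _
      (iterate_deriv_mem_topologicalClosure_span F (idx l) (x l))
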